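/- arXiv:1912.11436 — 3 statements merged into one kernel-verified Lean document; each statement's English description precedes it below -/
import Mathlib

section
/- (Theorem 1, crossfit version) Define T_n^swap(θ) by exchanging the roles of D₀ and D₁ (i.e., using an estimator θ̂₀ that is a measurable function of D₀ and evaluating the likelihood ratio on D₁), and let S_n(θ) = (T_n(θ) + T_n^swap(θ))/2. For any α ∈ (0,1), the set C_n = {θ ∈ Θ : S_n(θ) ≤ 1/α} satisfies P_{θ*}(θ* ∈ C_n) ≥ 1 − α for every θ* ∈ Θ. -/
open MeasureTheory
open scoped ENNReal

/-- The likelihood ratio `f / q` has expectation at most `∫ f` under the law with density `q`. -/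
lemma lintegral_div_withDensity_le {𝒴 : Type*} [MeasurableSpace 𝒴] (μ : Measure 𝒴)
    {f q : 𝒴 → ℝ≥0∞} (hf : Measurable f) (hq : Measurable q) :
    ∫⁻ y, f y / q y ∂(μ.withDensity q) ≤ ∫⁻ y, f y ∂μ := by
  refine (lintegral_withDensity_eq_lintegral_mul μ hq (hf.div hq)).trans_le ?_
  exact lintegral_mono fun y => ENNReal.mul_div_le

/-- The likelihood ratio of an i.i.d. sample from the density `q` has expectation at most one. -/
lemma lintegral_pi_prod_div_prod_le_one {𝒴 : Type*} [MeasurableSpace 𝒴] (μ : Measure 𝒴)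
    {ι : Type*} [Fintype ι] {f q : 𝒴 → ℝ≥0∞} (hf : Measurable f) (hq : Measurable q)
    (hf1 : ∫⁻ y, f y ∂μ ≤ 1) [IsProbabilityMeasure (μ.withDensity q)] :
    ∫⁻ x, (∏ i, f (x i)) / (∏ i, q (x i)) ∂(Measure.pi fun _ : ι => μ.withDensity q) ≤ 1 := by
  have hne : ∀ᵐ y ∂(μ.withDensity q), q y ≠ 0 := by
    rw [ae_withDensity_iff hq]
    exact .of_forall fun _ h => h
  have hae : ∀ᵐ x ∂(Measure.pi fun _ : ι => μ.withDensity q), ∀ i, q (x i) ≠ 0 :=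
    Filter.eventually_all.2 fun i =>
      (Measure.tendsto_eval_ae_ae (μ := fun _ : ι => μ.withDensity q) (i := i)).eventually hne
  calc
    _ = ∫⁻ x, ∏ i, f (x i) / q (x i) ∂(Measure.pi fun _ : ι => μ.withDensity q) := by
      refine lintegral_congr_ae (hae.mono fun x hx => ?_)
      exact (ENNReal.prod_div_distrib fun i _ _ _ _ => Or.inl (hx i)).symm
    _ = ∏ i : ι, ∫⁻ x, f (x i) / q (x i) ∂(Measure.pi fun _ : ι => μ.withDensity q) :=
      ProbabilityTheory.lintegral_prod_eq_prod_lintegral_of_indepFun Finset.univ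
        (fun i (x : ι → 𝒴) => f (x i) / q (x i))
        (ProbabilityTheory.iIndepFun_pi fun _ => (hf.div hq).aemeasurable)
        fun i => (hf.div hq).comp (measurable_pi_apply i)
    _ ≤ 1 := by
      refine Finset.prod_le_one' fun i _ => ?_
      refine ((measurePreserving_eval (fun _ : ι => μ.withDensity q) i).lintegral_comp
        (hf.div hq)).trans_le ?_
      exact (lintegral_div_withDensity_le μ hf hq).trans hf1

/-- **Markov's inequality** as a lower bound: a nonnegative variable of mean at most one is at most
`1 / α` with probability at least `1 - α`. -/
lemma ofReal_one_sub_le_measure_le_one_div {Ω : Type*} [MeasurableSpace Ω] (P : Measure Ω)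
    [IsProbabilityMeasure P] {S : Ω → ℝ≥0∞} (hS : Measurable S) (hS1 : ∫⁻ ω, S ω ∂P ≤ 1)
    {α : ℝ} (hα : 0 < α) :
    ENNReal.ofReal (1 - α) ≤ P {ω | S ω ≤ ENNReal.ofReal (1 / α)} := by
  have hmarkov : P {ω | ENNReal.ofReal (1 / α) ≤ S ω} ≤ ENNReal.ofReal α := by
    have hpos : 0 < 1 / α := by positivity
    refine (meas_ge_le_lintegral_div hS.aemeasurable (by simpa using hα)
      ENNReal.ofReal_ne_top).trans ((ENNReal.div_le_div_right hS1 _).trans_eq ?_)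
    rw [one_div, one_div, ENNReal.ofReal_inv_of_pos hα, inv_inv]
  have hcompl : P ({ω | S ω ≤ ENNReal.ofReal (1 / α)}ᶜ) ≤ ENNReal.ofReal α := by
    refine (measure_mono ?_).trans hmarkov
    exact fun ω hω => (le_total _ (S ω)).resolve_right hω
  rw [prob_compl_eq_one_sub (measurableSet_le hS measurable_const)] at hcompl
  rw [ENNReal.ofReal_sub _ hα.le, ENNReal.ofReal_one]
  exact tsub_le_iff_tsub_le.1 hcompl

/-- **Theorem 1, crossfit version.** With `Tₙ(θ)` the split LRT statistic
(estimator `θ̂₁` computed from `D₁ = ω.2`, likelihood ratio evaluated on `D₀ = ω.1`),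
`Tₙ^swap(θ)` its swapped version (estimator `θ̂₀` computed from `D₀`, likelihood ratio
evaluated on `D₁`), and `Sₙ(θ) = (Tₙ(θ) + Tₙ^swap(θ))/2`, the crossfit confidence set
`Cₙ = {θ : Sₙ(θ) ≤ 1/α}` satisfies `P_{θ*}(θ* ∈ Cₙ) ≥ 1 − α`. -/
theorem crossfit_confidence_set_coverage
    {𝒴 Θ : Type*} [MeasurableSpace 𝒴] [MeasurableSpace Θ]
    (μ : Measure 𝒴) [SigmaFinite μ] (n : ℕ)
    (p : Θ → 𝒴 → ℝ≥0∞) (hp_meas : Measurable (Function.uncurry p))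
    (hp1 : ∀ θ, ∫⁻ y, p θ y ∂μ = 1)
    [∀ θ, IsProbabilityMeasure (μ.withDensity (p θ))]
    (θstar : Θ)
    (hat1 : (Fin n → 𝒴) → Θ) (hhat1 : Measurable hat1)
    (hat0 : (Fin n → 𝒴) → Θ) (hhat0 : Measurable hat0)
    (α : ℝ) (hα : α ∈ Set.Ioo (0 : ℝ) 1) :
    ENNReal.ofReal (1 - α) ≤
      ((Measure.pi fun _ : Fin n => μ.withDensity (p θstar)).prod
        (Measure.pi fun _ : Fin n => μ.withDensity (p θstar)))
        {ω : (Fin n → 𝒴) × (Fin n → 𝒴) |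
          ((∏ i, p (hat1 ω.2) (ω.1 i)) / (∏ i, p θstar (ω.1 i))
            + (∏ i, p (hat0 ω.1) (ω.2 i)) / (∏ i, p θstar (ω.2 i))) / 2
            ≤ ENNReal.ofReal (1 / α)} := by
  have hq : Measurable (p θstar) := hp_meas.of_uncurry_left
  have hT : Measurable fun ω : (Fin n → 𝒴) × (Fin n → 𝒴) =>
      (∏ i, p (hat1 ω.2) (ω.1 i)) / (∏ i, p θstar (ω.1 i)) := by
    refine (Finset.measurable_prod _ fun i _ => ?_).div
      (Finset.measurable_prod _ fun i _ => hq.comp (by fun_prop))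
    exact hp_meas.comp (f := fun ω : (Fin n → 𝒴) × (Fin n → 𝒴) => (hat1 ω.2, ω.1 i))
      (by fun_prop)
  have hTswap : Measurable fun ω : (Fin n → 𝒴) × (Fin n → 𝒴) =>
      (∏ i, p (hat0 ω.1) (ω.2 i)) / (∏ i, p θstar (ω.2 i)) := by
    refine (Finset.measurable_prod _ fun i _ => ?_).div
      (Finset.measurable_prod _ fun i _ => hq.comp (by fun_prop))
    exact hp_meas.comp (f := fun ω : (Fin n → 𝒴) × (Fin n → 𝒴) => (hat0 ω.1, ω.2 i))
      (by fun_prop)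
  have hratio (θ : Θ) : ∫⁻ x, (∏ i, p θ (x i)) / (∏ i, p θstar (x i))
      ∂(Measure.pi fun _ : Fin n => μ.withDensity (p θstar)) ≤ 1 :=
    lintegral_pi_prod_div_prod_le_one μ hp_meas.of_uncurry_left hq (hp1 θ).le
  refine ofReal_one_sub_le_measure_le_one_div _ ((hT.add hTswap).div_const 2) ?_ hα.1
  simp_rw [div_eq_mul_inv _ (2 : ℝ≥0∞), Pi.add_apply]
  rw [lintegral_mul_const _ (by fun_prop), lintegral_add_left hT, ← div_eq_mul_inv]
  refine ENNReal.div_le_of_le_mul ?_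
  rw [one_mul, ← one_add_one_eq_two]
  refine add_le_add ?_ ?_
  · rw [lintegral_prod_symm' _ hT]
    exact (lintegral_mono fun y => hratio (hat1 y)).trans_eq (by simp)
  · rw [lintegral_prod _ hTswap.aemeasurable]
    exact (lintegral_mono fun x => hratio (hat0 x)).trans_eq (by simp)
end

section
/- (Nonparametric split LRT) Let 𝒫₀ and 𝒫₁ be arbitrary collections of probability densities with respect to μ, with no relationship assumed between them. Let p̂₁ be any element of 𝒫₁ chosen as a measurable function of D₁, and let p̂₀ ∈ 𝒫₀ be measurable with respect to D₀ and satisfy ∏_{i∈D₀} p̂₀(Yᵢ) ≥ ∏_{i∈D₀} p(Yᵢ) for all p ∈ 𝒫₀. Define U_n = ∏_{i∈D₀} p̂₁(Yᵢ)/p̂₀(Yᵢ). Then for every true density p* ∈ 𝒫₀ generating the i.i.d. data, P_{p*}(U_n > 1/α) ≤ α for any α ∈ (0,1). -/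
open MeasureTheory
open scoped ENNReal

/-- The integral of a product of functions of distinct coordinates under a product of probability
measures is the product of the integrals. -/
lemma lintegral_pi_prod_eq_prod {ι : Type*} [Fintype ι] {X : ι → Type*}
    [∀ i, MeasurableSpace (X i)] (P : ∀ i, Measure (X i)) [∀ i, IsProbabilityMeasure (P i)]
    {f : ∀ i, X i → ℝ≥0∞} (hf : ∀ i, Measurable (f i)) :
    ∫⁻ x, ∏ i, f i (x i) ∂Measure.pi P = ∏ i, ∫⁻ y, f i y ∂P i := by
  rw [ProbabilityTheory.lintegral_prod_eq_prod_lintegral_of_indepFun Finset.univ _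
    (ProbabilityTheory.iIndepFun_pi fun i => (hf i).aemeasurable)
    fun i => (hf i).comp (measurable_pi_apply i)]
  exact Finset.prod_congr rfl fun i _ => (measurePreserving_eval P i).lintegral_comp (hf i)

/-- The likelihood ratio of a sub-density against the true density has mean at most one. -/
lemma lintegral_likelihood_ratio_le_one {ι 𝒴 : Type*} [Fintype ι] [MeasurableSpace 𝒴]
    (μ : Measure 𝒴) {p q : 𝒴 → ℝ≥0∞} [IsProbabilityMeasure (μ.withDensity p)]
    (hp : Measurable p) (hq : Measurable q) (hq1 : ∫⁻ y, q y ∂μ ≤ 1) :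
    ∫⁻ x, (∏ i, q (x i)) / ∏ i, p (x i) ∂(Measure.pi fun _ : ι => μ.withDensity p) ≤ 1 := by
  have hpos : ∀ᵐ y ∂μ.withDensity p, p y ≠ 0 :=
    (ae_withDensity_iff hp).2 (ae_of_all _ fun _ h => h)
  have hae : ∀ᵐ x ∂(Measure.pi fun _ : ι => μ.withDensity p), ∀ i, p (x i) ≠ 0 :=
    ae_all_iff.2 fun i =>
      (measurePreserving_eval (fun _ : ι => μ.withDensity p) i).quasiMeasurePreserving.ae hpos
  have hratio : ∫⁻ y, q y / p y ∂μ.withDensity p ≤ 1 := by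
    refine (lintegral_withDensity_eq_lintegral_mul μ hp (hq.div hp)).trans_le ?_
    exact (lintegral_mono fun _ => ENNReal.mul_div_le).trans hq1
  calc ∫⁻ x, (∏ i, q (x i)) / ∏ i, p (x i) ∂(Measure.pi fun _ : ι => μ.withDensity p)
      = ∫⁻ x, ∏ i, q (x i) / p (x i) ∂(Measure.pi fun _ : ι => μ.withDensity p) := by
        refine lintegral_congr_ae ?_
        filter_upwards [hae] with x hx
        exact (ENNReal.prod_div_distrib_of_ne_zero fun i _ => hx i).symm
    _ = ∏ _i : ι, ∫⁻ y, q y / p y ∂μ.withDensity p :=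
        lintegral_pi_prod_eq_prod (fun _ => μ.withDensity p) fun _ => hq.div hp
    _ ≤ 1 := Finset.prod_le_one' fun _ _ => hratio

/-- **Nonparametric split LRT.** Let `𝒫₀` and `𝒫₁` be arbitrary collections
of probability densities with respect to `μ` (no relation assumed between them).  Let
`p̂₁ = phat1 D₁ ∈ 𝒫₁` be any estimator measurable in `D₁`, and let `p̂₀ = phat0 D₀ ∈ 𝒫₀`
maximize the `D₀`-likelihood over `𝒫₀`.  Then the nonparametric split LRT with statistic
`Uₙ = ∏_{i∈D₀} p̂₁(Yᵢ)/p̂₀(Yᵢ)` satisfies `P_{p*}(Uₙ > 1/α) ≤ α` for every true density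
`p* ∈ 𝒫₀` generating the i.i.d. data. -/
theorem nonparametric_split_LRT_type_I_error
    {𝒴 : Type*} [MeasurableSpace 𝒴] (μ : Measure 𝒴) [SigmaFinite μ] (n : ℕ)
    (𝒫₀ 𝒫₁ : Set (𝒴 → ℝ≥0∞))
    (h𝒫₀ : ∀ p ∈ 𝒫₀, Measurable p ∧ ∫⁻ y, p y ∂μ = 1)
    (h𝒫₁ : ∀ p ∈ 𝒫₁, Measurable p ∧ ∫⁻ y, p y ∂μ = 1)
    (pstar : 𝒴 → ℝ≥0∞) (hpstar : pstar ∈ 𝒫₀)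
    [IsProbabilityMeasure (μ.withDensity pstar)]
    (phat1 : (Fin n → 𝒴) → 𝒴 → ℝ≥0∞)
    (hphat1_mem : ∀ d : Fin n → 𝒴, phat1 d ∈ 𝒫₁)
    (hphat1_meas : Measurable (fun x : (Fin n → 𝒴) × 𝒴 => phat1 x.1 x.2))
    (phat0 : (Fin n → 𝒴) → 𝒴 → ℝ≥0∞)
    (hphat0_mem : ∀ d : Fin n → 𝒴, phat0 d ∈ 𝒫₀)
    (hphat0_max : ∀ d : Fin n → 𝒴, ∀ q ∈ 𝒫₀, (∏ i, q (d i)) ≤ ∏ i, phat0 d (d i))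
    (α : ℝ) (hα : α ∈ Set.Ioo (0 : ℝ) 1) :
    ((Measure.pi fun _ : Fin n => μ.withDensity pstar).prod
        (Measure.pi fun _ : Fin n => μ.withDensity pstar))
        {ω : (Fin n → 𝒴) × (Fin n → 𝒴) |
          ENNReal.ofReal (1 / α) <
            (∏ i, phat1 ω.2 (ω.1 i)) / (∏ i, phat0 ω.1 (ω.1 i))}
      ≤ ENNReal.ofReal α := by
  set Q := Measure.pi fun _ : Fin n => μ.withDensity pstar
  have hp := (h𝒫₀ pstar hpstar).1
  have hα0 : ENNReal.ofReal α ≠ 0 := (ENNReal.ofReal_pos.2 hα.1).ne'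
  set V : (Fin n → 𝒴) × (Fin n → 𝒴) → ℝ≥0∞ :=
    fun ω => (∏ i, phat1 ω.2 (ω.1 i)) / ∏ i, pstar (ω.1 i)
  have hV : Measurable V := by
    refine Measurable.div ?_ ?_
    · exact Finset.measurable_prod _ fun i _ => hphat1_meas.comp
        (measurable_snd.prodMk ((measurable_pi_apply i).comp measurable_fst))
    · exact Finset.measurable_prod _ fun i _ =>
        hp.comp ((measurable_pi_apply i).comp measurable_fst)
  have hmean : ∫⁻ ω, V ω ∂(Q.prod Q) ≤ 1 := by
    rw [lintegral_prod_symm' V hV]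
    calc ∫⁻ d, ∫⁻ x, V (x, d) ∂Q ∂Q ≤ ∫⁻ _, 1 ∂Q :=
          lintegral_mono fun d => lintegral_likelihood_ratio_le_one μ hp
            (h𝒫₁ _ (hphat1_mem d)).1 (h𝒫₁ _ (hphat1_mem d)).2.le
      _ = 1 := by simp [Q]
  have hinv : ENNReal.ofReal (1 / α) = (ENNReal.ofReal α)⁻¹ := by
    rw [one_div, ENNReal.ofReal_inv_of_pos hα.1]
  calc (Q.prod Q) _ ≤ (Q.prod Q) {ω | (ENNReal.ofReal α)⁻¹ ≤ V ω} := by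
        refine measure_mono fun ω hω => ?_
        rw [← hinv]
        exact (le_of_lt hω).trans (ENNReal.div_le_div_left (hphat0_max ω.1 pstar hpstar) _)
    _ ≤ (∫⁻ ω, V ω ∂(Q.prod Q)) / (ENNReal.ofReal α)⁻¹ :=
        meas_ge_le_lintegral_div hV.aemeasurable (ENNReal.inv_ne_zero.2 ENNReal.ofReal_ne_top)
          (ENNReal.inv_ne_top.2 hα0)
    _ ≤ 1 / (ENNReal.ofReal α)⁻¹ := ENNReal.div_le_div_right hmean _
    _ = ENNReal.ofReal α := by rw [one_div, inv_inv]
end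

section
/- (Smoothed split LRT) Let k : 𝒴 × 𝒴 → [0,∞) be a measurable kernel with ∫ k(x,y) dμ(y) = 1 for every x. For θ ∈ Θ define the smoothed density p̃_θ(y) = ∫ k(x,y) p_θ(x) dμ(x) and the smoothed likelihood on D₀ as L̃₀(θ) = ∏_{i∈D₀} exp(∫ k(Yᵢ, y) log p̃_θ(y) dμ(y)). Let θ̃₀ maximize L̃₀ over Θ₀ and let θ̂₁ ∈ Θ be any estimator measurable with respect to D₁. Then the smoothed split LRT, which rejects H₀: θ* ∈ Θ₀ when Ũ_n = L̃₀(θ̂₁)/L̃₀(θ̃₀) > 1/α, satisfies sup_{θ* ∈ Θ₀} P_{θ*}(Ũ_n > 1/α) ≤ α for any α ∈ (0,1). -/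
open MeasureTheory
open scoped ENNReal

/-- **Jensen's inequality** for the exponential, with no integrability assumption on `exp ∘ f`. -/
theorem ofReal_exp_integral_le_lintegral {α : Type*} [MeasurableSpace α] {ν : Measure α}
    [IsProbabilityMeasure ν] {f : α → ℝ} (hf : Integrable f ν) :
    ENNReal.ofReal (Real.exp (∫ y, f y ∂ν)) ≤ ∫⁻ y, ENNReal.ofReal (Real.exp (f y)) ∂ν := by
  by_cases hfin : ∫⁻ y, ENNReal.ofReal (Real.exp (f y)) ∂ν = ⊤
  · simp [hfin]
  have hexp : Integrable (fun y => Real.exp (f y)) ν := by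
    refine ⟨Real.continuous_exp.comp_aestronglyMeasurable hf.1, ?_⟩
    rw [hasFiniteIntegral_iff_ofReal (ae_of_all _ fun y => (Real.exp_pos _).le)]
    exact lt_top_iff_ne_top.2 hfin
  rw [← ofReal_integral_eq_lintegral_ofReal hexp (ae_of_all _ fun y => (Real.exp_pos _).le)]
  exact ENNReal.ofReal_le_ofReal <| convexOn_exp.map_integral_le Real.continuous_exp.continuousOn
    isClosed_univ (by simp) hf hexp

/-- Jensen's inequality for the average of a log-ratio against a probability density. -/
theorem ofReal_exp_integral_log_sub_le {α : Type*} [MeasurableSpace α] {μ : Measure α}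
    {κ a b : α → ℝ≥0∞} (hκ : Measurable κ) (hκ1 : ∫⁻ y, κ y ∂μ = 1)
    (ha : Measurable a) (hb : Measurable b)
    (ha0 : ∀ y, 0 < a y) (ha_top : ∀ y, a y < ⊤) (hb0 : ∀ y, 0 < b y) (hb_top : ∀ y, b y < ⊤)
    (hai : Integrable (fun y => (κ y).toReal * Real.log (a y).toReal) μ)
    (hbi : Integrable (fun y => (κ y).toReal * Real.log (b y).toReal) μ) :
    ENNReal.ofReal (Real.exp (∫ y, (κ y).toReal * Real.log (a y).toReal ∂μ
        - ∫ y, (κ y).toReal * Real.log (b y).toReal ∂μ))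
      ≤ ∫⁻ y, κ y * (a y / b y) ∂μ := by
  have hκ_top : ∀ᵐ y ∂μ, κ y < ⊤ := ae_lt_top hκ (by simp [hκ1])
  have : IsProbabilityMeasure (μ.withDensity κ) := ⟨by simp [hκ1]⟩
  have hint : Integrable (fun y => Real.log (a y).toReal - Real.log (b y).toReal)
      (μ.withDensity κ) := by
    rw [integrable_withDensity_iff_integrable_smul' hκ hκ_top]
    simp only [smul_eq_mul, mul_sub]
    exact hai.sub hbi
  have hjensen := ofReal_exp_integral_le_lintegral hint
  rw [integral_withDensity_eq_integral_toReal_smul hκ hκ_top] at hjensen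
  simp only [smul_eq_mul, mul_sub] at hjensen
  rw [integral_sub hai hbi] at hjensen
  refine hjensen.trans_eq ?_
  have hratio : ∀ y, ENNReal.ofReal
      (Real.exp (Real.log (a y).toReal - Real.log (b y).toReal)) = a y / b y := by
    intro y
    have ha' := ENNReal.toReal_pos (ha0 y).ne' (ha_top y).ne
    have hb' := ENNReal.toReal_pos (hb0 y).ne' (hb_top y).ne
    rw [Real.exp_sub, Real.exp_log ha', Real.exp_log hb', ENNReal.ofReal_div_of_pos hb',
      ENNReal.ofReal_toReal (ha_top y).ne, ENNReal.ofReal_toReal (hb_top y).ne]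
  simp_rw [hratio]
  exact lintegral_withDensity_eq_lintegral_mul μ hκ (ha.div hb)

/-- Smoothing a probability density by a Markov kernel density preserves its total mass. -/
theorem lintegral_lintegral_kernel_mul {α : Type*} [MeasurableSpace α] {μ : Measure α}
    [SFinite μ] {k : α → α → ℝ≥0∞} (hk : Measurable (Function.uncurry k))
    (hk1 : ∀ x, ∫⁻ y, k x y ∂μ = 1) {q : α → ℝ≥0∞} (hq : Measurable q) :
    ∫⁻ y, ∫⁻ x, k x y * q x ∂μ ∂μ = ∫⁻ x, q x ∂μ := by
  have hmeas : Measurable (Function.uncurry fun y x => k x y * q x) :=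
    (hk.comp measurable_swap).mul (hq.comp measurable_snd)
  rw [lintegral_lintegral_swap hmeas.aemeasurable]
  refine lintegral_congr fun x => ?_
  have hkx : Measurable (k x) := hk.comp measurable_prodMk_left
  rw [lintegral_mul_const _ hkx, hk1, one_mul]

/-- The expectation of a kernel-averaged ratio `a / b`, when `b` is the smoothing of the sampling
density `q`, is the total mass of `a`. -/
theorem lintegral_withDensity_kernel_ratio {α : Type*} [MeasurableSpace α] {μ : Measure α}
    [SFinite μ] {k : α → α → ℝ≥0∞} (hk : Measurable (Function.uncurry k))
    {q a b : α → ℝ≥0∞} (hq : Measurable q) (ha : Measurable a) (hb : Measurable b)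
    (hbq : ∀ y, b y = ∫⁻ x, k x y * q x ∂μ) (hb0 : ∀ y, 0 < b y) (hb_top : ∀ y, b y < ⊤) :
    ∫⁻ x, ∫⁻ y, k x y * (a y / b y) ∂μ ∂(μ.withDensity q) = ∫⁻ y, a y ∂μ := by
  have hr : Measurable fun y => a y / b y := ha.div hb
  have hkr : Measurable (Function.uncurry fun x y => k x y * (a y / b y)) :=
    hk.mul (hr.comp measurable_snd)
  rw [lintegral_withDensity_eq_lintegral_mul μ hq hkr.lintegral_prod_right]
  have hpull : ∀ x, (q * fun x => ∫⁻ y, k x y * (a y / b y) ∂μ) x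
      = ∫⁻ y, q x * (k x y * (a y / b y)) ∂μ := fun x =>
    (lintegral_const_mul _ (hkr.comp measurable_prodMk_left)).symm
  simp_rw [hpull]
  have hmeas : Measurable (Function.uncurry fun x y => q x * (k x y * (a y / b y))) :=
    (hq.comp measurable_fst).mul hkr
  rw [lintegral_lintegral_swap hmeas.aemeasurable]
  refine lintegral_congr fun y => ?_
  have hkq : Measurable fun x => k x y * q x := (hk.comp measurable_prodMk_right).mul hq
  calc ∫⁻ x, q x * (k x y * (a y / b y)) ∂μ
      = ∫⁻ x, (k x y * q x) * (a y / b y) ∂μ := lintegral_congr fun x => by ring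
    _ = b y * (a y / b y) := by rw [lintegral_mul_const _ hkq, ← hbq]
    _ = a y := ENNReal.mul_div_cancel (hb0 y).ne' (hb_top y).ne

/-- The integral over a product of probability measures of a product of functions of the separate
coordinates is the product of the integrals. -/
theorem lintegral_pi_prod_eval {ι α : Type*} [Fintype ι] [MeasurableSpace α] {P : Measure α}
    [IsProbabilityMeasure P] {F : α → ℝ≥0∞} (hF : Measurable F) :
    ∫⁻ d : ι → α, ∏ i, F (d i) ∂(Measure.pi fun _ : ι => P) = ∏ _i : ι, ∫⁻ x, F x ∂P := by
  rw [ProbabilityTheory.lintegral_prod_eq_prod_lintegral_of_indepFun Finset.univ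
    (fun i (d : ι → α) => F (d i))
    (ProbabilityTheory.iIndepFun_pi (X := fun _ => F) fun _ => hF.aemeasurable)
    fun i => hF.comp (measurable_pi_apply i)]
  exact Finset.prod_congr rfl fun i _ =>
    (measurePreserving_eval (fun _ : ι => P) i).lintegral_comp hF

/-- **Smoothed split LRT.** Let `k : 𝒴 × 𝒴 → [0,∞)` be a measurable kernel
with `∫ k x y dμ(y) = 1` for every `x`, let `p̃_θ (y) = ∫ k x y * p θ x dμ(x)` be the
smoothed densities (assumed positive and finite), and let the smoothed log-likelihood on
`D₀ = d` be `sll θ d = ∑_{i} ∫ k (d i) y * log p̃_θ(y) dμ(y)`, so that the smoothed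
likelihood is `L̃₀(θ) = exp (sll θ d)`.  Let `θ̃₀ = tilde0 D₀ ∈ Θ₀` maximize the smoothed
likelihood over `Θ₀` and let `θ̂₁ = hat1 D₁ ∈ Θ` be any estimator measurable in `D₁`.
Then the smoothed split LRT, rejecting `H₀ : θ* ∈ Θ₀` when
`Ũₙ = L̃₀(θ̂₁)/L̃₀(θ̃₀) > 1/α`, satisfies `P_{θ*}(Ũₙ > 1/α) ≤ α` for every `θ* ∈ Θ₀`. -/
theorem smoothed_split_LRT_type_I_error
    {𝒴 Θ : Type*} [MeasurableSpace 𝒴] [MeasurableSpace Θ]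
    (μ : Measure 𝒴) [SigmaFinite μ] (n : ℕ)
    (p : Θ → 𝒴 → ℝ≥0∞) (hp_meas : Measurable (Function.uncurry p))
    (hp1 : ∀ θ, ∫⁻ y, p θ y ∂μ = 1)
    [∀ θ, IsProbabilityMeasure (μ.withDensity (p θ))]
    (k : 𝒴 → 𝒴 → ℝ≥0∞) (hk_meas : Measurable (Function.uncurry k))
    (hk1 : ∀ x, ∫⁻ y, k x y ∂μ = 1)
    (ptilde : Θ → 𝒴 → ℝ≥0∞)
    (hptilde : ∀ θ y, ptilde θ y = ∫⁻ x, k x y * p θ x ∂μ)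
    (hptilde_pos : ∀ θ y, 0 < ptilde θ y) (hptilde_fin : ∀ θ y, ptilde θ y < ⊤)
    (sll : Θ → (Fin n → 𝒴) → ℝ)
    (hsll : ∀ θ d, sll θ d = ∑ i, ∫ y, (k (d i) y).toReal * Real.log (ptilde θ y).toReal ∂μ)
    (hsll_int : ∀ θ x, Integrable (fun y => (k x y).toReal * Real.log (ptilde θ y).toReal) μ)
    (Θ₀ : Set Θ) (θstar : Θ) (hθstar : θstar ∈ Θ₀)
    (hat1 : (Fin n → 𝒴) → Θ) (hhat1 : Measurable hat1)
    (tilde0 : (Fin n → 𝒴) → Θ) (htilde0_meas : Measurable tilde0)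
    (htilde0_mem : ∀ d : Fin n → 𝒴, tilde0 d ∈ Θ₀)
    (htilde0_max : ∀ d : Fin n → 𝒴, ∀ θ ∈ Θ₀, sll θ d ≤ sll (tilde0 d) d)
    (α : ℝ) (hα : α ∈ Set.Ioo (0 : ℝ) 1) :
    ((Measure.pi fun _ : Fin n => μ.withDensity (p θstar)).prod
        (Measure.pi fun _ : Fin n => μ.withDensity (p θstar)))
        {ω : (Fin n → 𝒴) × (Fin n → 𝒴) |
          1 / α < Real.exp (sll (hat1 ω.2) ω.1) / Real.exp (sll (tilde0 ω.1) ω.1)}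
      ≤ ENNReal.ofReal α := by
  have hpt : Measurable (Function.uncurry ptilde) := by
    have h : Measurable fun z : (Θ × 𝒴) × 𝒴 => k z.2 z.1.2 * p z.1.1 z.2 :=
      (hk_meas.comp (measurable_snd.prodMk (measurable_snd.comp measurable_fst))).mul
        (hp_meas.comp ((measurable_fst.comp measurable_fst).prodMk measurable_snd))
    have heq : Function.uncurry ptilde
        = fun w : Θ × 𝒴 => ∫⁻ x, k x w.2 * p w.1 x ∂μ := funext fun w => hptilde w.1 w.2
    rw [heq]
    exact h.lintegral_prod_right'
  have hpt_left : ∀ θ, Measurable (ptilde θ) := fun θ => hpt.comp measurable_prodMk_left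
  have hp_left : ∀ θ, Measurable (p θ) := fun θ => hp_meas.comp measurable_prodMk_left
  let G : Θ → 𝒴 → ℝ := fun θ x => ∫ y, (k x y).toReal * Real.log (ptilde θ y).toReal ∂μ
  have hG : Measurable (Function.uncurry G) := by
    have h : Measurable fun z : (Θ × 𝒴) × 𝒴 =>
        (k z.1.2 z.2).toReal * Real.log (ptilde z.1.1 z.2).toReal :=
      (hk_meas.comp ((measurable_snd.comp measurable_fst).prodMk
        measurable_snd)).ennreal_toReal.mul
        (hpt.comp ((measurable_fst.comp measurable_fst).prodMk
          measurable_snd)).ennreal_toReal.log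
    exact h.stronglyMeasurable.integral_prod_right'.measurable
  let F : Θ → 𝒴 → ℝ≥0∞ := fun ψ x => ENNReal.ofReal (Real.exp (G ψ x - G θstar x))
  have hF : Measurable (Function.uncurry F) :=
    (hG.sub (hG.comp (measurable_const.prodMk measurable_snd))).exp.ennreal_ofReal
  have hF_le : ∀ ψ, ∫⁻ x, F ψ x ∂(μ.withDensity (p θstar)) ≤ 1 := by
    intro ψ
    calc ∫⁻ x, F ψ x ∂(μ.withDensity (p θstar))
        ≤ ∫⁻ x, ∫⁻ y, k x y * (ptilde ψ y / ptilde θstar y) ∂μ ∂(μ.withDensity (p θstar)) :=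
          lintegral_mono fun x => ofReal_exp_integral_log_sub_le
            (hk_meas.comp measurable_prodMk_left) (hk1 x) (hpt_left ψ) (hpt_left θstar)
            (hptilde_pos ψ) (hptilde_fin ψ) (hptilde_pos θstar) (hptilde_fin θstar)
            (hsll_int ψ x) (hsll_int θstar x)
      _ = ∫⁻ y, ptilde ψ y ∂μ :=
          lintegral_withDensity_kernel_ratio hk_meas (hp_left θstar) (hpt_left ψ)
            (hpt_left θstar) (hptilde θstar) (hptilde_pos θstar) (hptilde_fin θstar)
      _ = 1 := by
          simp_rw [hptilde ψ]
          rw [lintegral_lintegral_kernel_mul hk_meas hk1 (hp_left ψ), hp1]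
  let R : (Fin n → 𝒴) × (Fin n → 𝒴) → ℝ≥0∞ := fun ω => ∏ i, F (hat1 ω.2) (ω.1 i)
  have hR : Measurable R := Finset.measurable_fun_prod _ fun i _ =>
    hF.comp ((hhat1.comp measurable_snd).prodMk ((measurable_pi_apply i).comp measurable_fst))
  set Q := Measure.pi fun _ : Fin n => μ.withDensity (p θstar)
  have hR_le : ∫⁻ ω, R ω ∂(Q.prod Q) ≤ 1 := by
    rw [lintegral_prod_symm' _ hR]
    calc ∫⁻ e, ∫⁻ d, R (d, e) ∂Q ∂Q ≤ ∫⁻ _, 1 ∂Q := by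
          refine lintegral_mono fun e => ?_
          have hFe : Measurable (F (hat1 e)) := hF.comp measurable_prodMk_left
          refine (lintegral_pi_prod_eval hFe).trans_le ?_
          exact Finset.prod_le_one' fun _ _ => hF_le (hat1 e)
      _ = 1 := by simp
  have hsub : {ω : (Fin n → 𝒴) × (Fin n → 𝒴) |
      1 / α < Real.exp (sll (hat1 ω.2) ω.1) / Real.exp (sll (tilde0 ω.1) ω.1)}
      ⊆ {ω | ENNReal.ofReal (1 / α) ≤ R ω} := by
    intro ω hω
    have hRω : R ω = ENNReal.ofReal (Real.exp (sll (hat1 ω.2) ω.1 - sll θstar ω.1)) := by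
      rw [hsll, hsll, ← Finset.sum_sub_distrib, Real.exp_sum,
        ENNReal.ofReal_prod_of_nonneg fun i _ => (Real.exp_pos _).le]
    rw [Set.mem_ofPred_eq, hRω]
    rw [Set.mem_ofPred_eq, ← Real.exp_sub] at hω
    refine ENNReal.ofReal_le_ofReal (hω.le.trans (Real.exp_le_exp.2 ?_))
    exact sub_le_sub_left (htilde0_max ω.1 θstar hθstar) _
  have hα_inv : 0 < 1 / α := one_div_pos.2 hα.1
  calc (Q.prod Q) _ ≤ (Q.prod Q) {ω | ENNReal.ofReal (1 / α) ≤ R ω} := measure_mono hsub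
    _ ≤ (∫⁻ ω, R ω ∂(Q.prod Q)) / ENNReal.ofReal (1 / α) :=
        meas_ge_le_lintegral_div hR.aemeasurable (ENNReal.ofReal_pos.2 hα_inv).ne'
          ENNReal.ofReal_ne_top
    _ ≤ 1 / ENNReal.ofReal (1 / α) := ENNReal.div_le_div_right hR_le _
    _ = ENNReal.ofReal α := by
        rw [one_div, ← ENNReal.ofReal_inv_of_pos hα_inv, one_div, inv_inv]
end
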